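/- For every real κ > −d and every r > 0 the recursion I(d,κ,r) = (α/r^α) · I(d+2, κ+α−2, r) − κ · I(d+2, κ−2, r) holds. -/

import Mathlib

open MeasureTheory Filter

/-- The Bessel function of the first kind of order `μ`, defined by its power series. -/
noncomputable def besselJ (μ t : ℝ) : ℝ :=
  ∑' n : ℕ, ((-1 : ℝ) ^ n / ((n.factorial : ℝ) * Real.Gamma ((n : ℝ) + μ + 1))) *
    (t / 2) ^ (2 * (n : ℝ) + μ)

/-- `I(m,κ,r) = ∫₀^∞ t^{m/2+κ} e^{-(t/r)^α} J_{m/2-1}(t) dt`. -/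
noncomputable def Ifun (m : ℕ) (α κ r : ℝ) : ℝ :=
  ∫ t in Set.Ioi (0 : ℝ),
    t ^ ((m : ℝ) / 2 + κ) * Real.exp (-(t / r) ^ α) * besselJ ((m : ℝ) / 2 - 1) t

/-- The coefficients of the entire function `besselPhi μ`. -/
noncomputable def besselCoeff (μ : ℝ) (n : ℕ) : ℝ :=
  (-1 : ℝ) ^ n / ((n.factorial : ℝ) * Real.Gamma ((n : ℝ) + μ + 1))

/-- The entire function with `besselJ μ t = (t / 2) ^ μ * besselPhi μ ((t / 2) ^ 2)`. -/
noncomputable def besselPhi (μ x : ℝ) : ℝ := ∑' n : ℕ, besselCoeff μ n * x ^ n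

lemma besselJ_eq_rpow_mul_besselPhi (μ : ℝ) {t : ℝ} (ht : 0 < t) :
    besselJ μ t = (t / 2) ^ μ * besselPhi μ ((t / 2) ^ 2) := by
  rw [besselJ, besselPhi, ← tsum_mul_left]
  refine tsum_congr fun n => ?_
  have h : (t / 2) ^ (2 * (n : ℝ) + μ) = (t / 2) ^ μ * ((t / 2) ^ 2) ^ n := by
    rw [Real.rpow_add (by positivity), ← pow_mul, mul_comm, ← Real.rpow_natCast]
    push_cast
    rfl
  rw [h, besselCoeff]
  ring

lemma besselCoeff_succ_mul {μ : ℝ} (n : ℕ) :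
    ((n + 1 : ℕ) : ℝ) * besselCoeff μ (n + 1) = -besselCoeff (μ + 1) n := by
  unfold besselCoeff
  have h : ((n + 1 : ℕ) : ℝ) + μ + 1 = (n : ℝ) + (μ + 1) + 1 := by push_cast; ring
  rw [h, Nat.factorial_succ, pow_succ]
  have : ((n + 1 : ℕ) : ℝ) ≠ 0 := by positivity
  push_cast at this ⊢
  field_simp

lemma besselCoeff_sub_one {ν : ℝ} (hν : 0 < ν) (n : ℕ) :
    besselCoeff (ν - 1) n = ν * besselCoeff ν n + n * besselCoeff ν n := by
  unfold besselCoeff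
  have h : (n : ℝ) + ν ≠ 0 := by positivity
  have hG : Real.Gamma ((n : ℝ) + ν) ≠ 0 := (Real.Gamma_pos_of_pos (by positivity)).ne'
  rw [show (n : ℝ) + (ν - 1) + 1 = n + ν by ring, Real.Gamma_add_one h]
  field_simp
  ring

lemma besselCoeff_ne_zero {μ : ℝ} (hμ : -1 < μ) (n : ℕ) : besselCoeff μ n ≠ 0 := by
  have : (0 : ℝ) < n + μ + 1 := by linarith [n.cast_nonneg (α := ℝ)]
  have := Real.Gamma_pos_of_pos this
  unfold besselCoeff
  positivity

lemma besselCoeff_succ {μ : ℝ} (hμ : -1 < μ) (n : ℕ) :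
    besselCoeff μ (n + 1) = -besselCoeff μ n / ((n + 1) * (n + μ + 1)) := by
  unfold besselCoeff
  have h : (0 : ℝ) < n + μ + 1 := by linarith [n.cast_nonneg (α := ℝ)]
  have hG := (Real.Gamma_pos_of_pos h).ne'
  have h1 : ((n + 1 : ℕ) : ℝ) + μ + 1 = (n + μ + 1) + 1 := by push_cast; ring
  rw [h1, Real.Gamma_add_one h.ne', Nat.factorial_succ, pow_succ]
  push_cast
  field_simp

lemma summable_besselCoeff_mul_pow {μ : ℝ} (hμ : -1 < μ) (x : ℝ) :
    Summable fun n : ℕ => besselCoeff μ n * x ^ n := by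
  rcases eq_or_ne x 0 with rfl | hx
  · refine summable_of_ne_finset_zero (s := {0}) fun n hn => ?_
    simp at hn
    simp [hn]
  refine summable_of_ratio_test_tendsto_lt_one (l := 0) one_pos
    (Eventually.of_forall fun n => mul_ne_zero (besselCoeff_ne_zero hμ n) (pow_ne_zero n hx)) ?_
  have h1 : Tendsto (fun n : ℕ => ((n : ℝ) + 1) * (n + μ + 1)) atTop atTop := by
    refine Tendsto.atTop_mul_atTop₀ ?_ ?_
    · exact tendsto_atTop_add_const_right _ _ tendsto_natCast_atTop_atTop
    · simp_rw [add_assoc]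
      exact tendsto_atTop_add_const_right _ _ tendsto_natCast_atTop_atTop
  refine (h1.const_div_atTop |x|).congr fun n => ?_
  have h : (0 : ℝ) < n + μ + 1 := by linarith [n.cast_nonneg (α := ℝ)]
  have hc := abs_ne_zero.mpr (besselCoeff_ne_zero hμ n)
  have hx' := abs_ne_zero.mpr hx
  simp only [besselCoeff_succ hμ, Real.norm_eq_abs, abs_mul, abs_div, abs_neg, abs_pow, pow_succ]
  rw [abs_of_pos h, abs_of_pos (by positivity : (0 : ℝ) < n + 1)]
  field_simp

lemma hasDerivAt_besselPhi {μ : ℝ} (hμ : -1 < μ) (x : ℝ) :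
    HasDerivAt (besselPhi μ) (-besselPhi (μ + 1) x) x := by
  have hsum (y : ℝ) : Summable fun n : ℕ => besselCoeff μ n * (n * y ^ (n - 1)) := by
    rw [← summable_nat_add_iff 1]
    refine (summable_besselCoeff_mul_pow (μ := μ + 1) (by linarith) y).neg.congr fun n => ?_
    rw [← neg_mul, ← besselCoeff_succ_mul, Nat.add_sub_cancel]
    ring
  have hd : HasDerivAt (besselPhi μ) (∑' n : ℕ, besselCoeff μ n * (n * x ^ (n - 1))) x := by
    refine hasDerivAt_tsum_of_isPreconnected (t := Metric.ball (0 : ℝ) (|x| + 1))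
      (u := fun n => |besselCoeff μ n * (n * (|x| + 1) ^ (n - 1))|) (y₀ := 0)
      (g := fun n y => besselCoeff μ n * y ^ n)
      (g' := fun n y => besselCoeff μ n * (n * y ^ (n - 1)))
      (hsum _).abs Metric.isOpen_ball (convex_ball _ _).isPreconnected
      (fun n y _ => (hasDerivAt_pow n y).const_mul _) (fun n y hy => ?_)
      (Metric.mem_ball_self (by positivity)) (summable_besselCoeff_mul_pow hμ 0)
      (mem_ball_zero_iff.mpr (lt_add_one |x|))
    have hy' : |y| ≤ |x| + 1 := by simpa using (mem_ball_zero_iff.mp hy).le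
    simp only [Real.norm_eq_abs, abs_mul, abs_pow]
    rw [abs_of_nonneg (by positivity : 0 ≤ |x| + 1)]
    gcongr
  refine hd.congr_deriv ?_
  rw [(hsum x).tsum_eq_zero_add, besselPhi, ← tsum_neg]
  simp only [Nat.cast_zero, zero_mul, mul_zero, zero_add, Nat.add_sub_cancel]
  refine tsum_congr fun n => ?_
  rw [← neg_mul, ← besselCoeff_succ_mul]
  ring

lemma besselPhi_sub_one {ν : ℝ} (hν : 0 < ν) (x : ℝ) :
    besselPhi (ν - 1) x = ν * besselPhi ν x - x * besselPhi (ν + 1) x := by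
  have h1 := summable_besselCoeff_mul_pow (μ := ν) (by linarith) x
  have h0 := summable_besselCoeff_mul_pow (μ := ν - 1) (by linarith) x
  have h2 : Summable fun n : ℕ => n * besselCoeff ν n * x ^ n :=
    (h0.sub (h1.mul_left ν)).congr fun n => by rw [besselCoeff_sub_one hν]; ring
  have h3 : ∑' n : ℕ, n * besselCoeff ν n * x ^ n = -(x * besselPhi (ν + 1) x) := by
    rw [h2.tsum_eq_zero_add, besselPhi, ← tsum_mul_left, ← tsum_neg]
    simp only [Nat.cast_zero, zero_mul, zero_add]
    refine tsum_congr fun n => ?_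
    rw [besselCoeff_succ_mul]
    ring
  rw [sub_eq_add_neg (ν * _), ← h3]
  simp only [besselPhi]
  rw [← tsum_mul_left, ← (h1.mul_left ν).tsum_add h2]
  refine tsum_congr fun n => ?_
  rw [besselCoeff_sub_one hν]
  ring

lemma hasDerivAt_besselJ {μ : ℝ} (hμ : -1 < μ) {t : ℝ} (ht : 0 < t) :
    HasDerivAt (besselJ μ) (μ / t * besselJ μ t - besselJ (μ + 1) t) t := by
  have h1 : HasDerivAt (fun s : ℝ => s / 2) (1 / 2) t := (hasDerivAt_id t).div_const 2
  have h2 := h1.rpow_const (p := μ) (Or.inl (by positivity))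
  have h3 := (hasDerivAt_besselPhi hμ ((t / 2) ^ 2)).comp t (h1.pow 2)
  have h4 := (h2.mul h3).congr_of_eventuallyEq (f₁ := besselJ μ) (by
    filter_upwards [lt_mem_nhds ht] with s hs
    exact besselJ_eq_rpow_mul_besselPhi μ hs)
  refine h4.congr_deriv ?_
  rw [besselJ_eq_rpow_mul_besselPhi μ ht, besselJ_eq_rpow_mul_besselPhi _ ht,
    Real.rpow_sub_one (by positivity), Real.rpow_add_one (by positivity)]
  simp only [Function.comp_apply, Pi.pow_apply]
  field_simp
  ring

lemma besselJ_sub_one_add_besselJ_add_one {ν : ℝ} (hν : 0 < ν) {t : ℝ} (ht : 0 < t) :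
    besselJ (ν - 1) t + besselJ (ν + 1) t = 2 * ν / t * besselJ ν t := by
  rw [besselJ_eq_rpow_mul_besselPhi _ ht, besselJ_eq_rpow_mul_besselPhi _ ht,
    besselJ_eq_rpow_mul_besselPhi _ ht, besselPhi_sub_one hν,
    Real.rpow_sub_one (by positivity), Real.rpow_add_one (by positivity)]
  field_simp
  ring

lemma hasDerivAt_besselJ' {ν : ℝ} (hν : 0 < ν) {t : ℝ} (ht : 0 < t) :
    HasDerivAt (besselJ ν) (besselJ (ν - 1) t - ν / t * besselJ ν t) t := by
  refine (hasDerivAt_besselJ (by linarith : -1 < ν) ht).congr_deriv ?_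
  linear_combination -besselJ_sub_one_add_besselJ_add_one hν ht

lemma hasDerivAt_rpow_mul_besselJ {ν : ℝ} (hν : 0 < ν) {t : ℝ} (ht : 0 < t) :
    HasDerivAt (fun s => s ^ ν * besselJ ν s) (t ^ ν * besselJ (ν - 1) t) t := by
  refine (((hasDerivAt_id t).rpow_const (p := ν) (Or.inl ht.ne')).mul
    (hasDerivAt_besselJ' hν ht)).congr_deriv ?_
  simp only [id, Real.rpow_sub_one ht.ne']
  field_simp
  ring

lemma continuousOn_besselJ {μ : ℝ} (hμ : -1 < μ) : ContinuousOn (besselJ μ) (Set.Ioi 0) :=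
  fun _ ht => (hasDerivAt_besselJ hμ ht).continuousAt.continuousWithinAt

lemma exists_abs_besselJ_le_rpow_of_le_one {μ : ℝ} (hμ : -1 < μ) :
    ∃ C, 0 ≤ C ∧ ∀ t, 0 < t → t ≤ 1 → |besselJ μ t| ≤ C * t ^ μ := by
  have hc : Continuous fun t : ℝ => besselPhi μ ((t / 2) ^ 2) :=
    (continuous_iff_continuousAt.mpr fun x => (hasDerivAt_besselPhi hμ x).continuousAt).comp
      (by fun_prop)
  obtain ⟨M, hM⟩ := (isCompact_Icc (a := (0 : ℝ)) (b := 1)).exists_bound_of_continuousOn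
    hc.continuousOn
  have hM0 : 0 ≤ M := (norm_nonneg _).trans (hM 0 (by simp))
  refine ⟨(2 ^ μ)⁻¹ * M, by positivity, fun t ht ht1 => ?_⟩
  have h := hM t ⟨ht.le, ht1⟩
  rw [Real.norm_eq_abs] at h
  rw [besselJ_eq_rpow_mul_besselPhi μ ht, abs_mul, abs_of_pos (by positivity),
    Real.div_rpow ht.le zero_le_two]
  calc t ^ μ / 2 ^ μ * |besselPhi μ ((t / 2) ^ 2)| ≤ t ^ μ / 2 ^ μ * M := by gcongr
    _ = _ := by ring

lemma besselJ_sq_add_sq_le {ν : ℝ} (hν : 0 < ν) {t : ℝ} (ht : 1 ≤ t) :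
    besselJ (ν - 1) t ^ 2 + besselJ ν t ^ 2 ≤
      (besselJ (ν - 1) 1 ^ 2 + besselJ ν 1 ^ 2) * t ^ (2 * ν) := by
  set E : ℝ → ℝ := fun s => (besselJ (ν - 1) s ^ 2 + besselJ ν s ^ 2) * s ^ (-(2 * ν)) with hE
  have hd (s : ℝ) (hs : 0 < s) : HasDerivAt E
      (-(s ^ (-(2 * ν)) / s * (2 * besselJ (ν - 1) s ^ 2 + 4 * ν * besselJ ν s ^ 2))) s := by
    have ha := hasDerivAt_besselJ (μ := ν - 1) (by linarith) hs
    have hb := hasDerivAt_besselJ' hν hs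
    have hp := (hasDerivAt_id s).rpow_const (p := -(2 * ν)) (Or.inl hs.ne')
    refine (((ha.pow 2).add (hb.pow 2)).mul hp).congr_deriv ?_
    simp only [id, Real.rpow_sub_one hs.ne', sub_add_cancel, Pi.add_apply, Pi.pow_apply]
    field_simp
    ring
  have hanti : AntitoneOn E (Set.Ici 1) := by
    refine antitoneOn_of_deriv_nonpos (convex_Ici 1)
      (fun s hs => (hd s (one_pos.trans_le hs)).continuousAt.continuousWithinAt)
      (fun s hs => ?_) (fun s hs => ?_) <;> rw [interior_Ici, Set.mem_Ioi] at hs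
    · exact (hd s (by linarith)).differentiableAt.differentiableWithinAt
    · have hs0 : 0 < s := by linarith
      rw [(hd s hs0).deriv, neg_nonpos]
      positivity
  have ht0 : 0 < t := by linarith
  have h := hanti Set.self_mem_Ici ht ht
  simp only [hE, Real.one_rpow, mul_one, Real.rpow_neg ht0.le] at h
  rwa [← div_eq_mul_inv, div_le_iff₀ (by positivity)] at h

lemma exists_abs_besselJ_le {ν μ : ℝ} (hν : 0 < ν) (hμ : μ = ν - 1 ∨ μ = ν) :
    ∃ C, 0 ≤ C ∧ ∀ t, 0 < t → |besselJ μ t| ≤ C * (t ^ μ + t ^ ν) := by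
  have hμ1 : -1 < μ := by rcases hμ with rfl | rfl <;> linarith
  obtain ⟨C, hC, h⟩ := exists_abs_besselJ_le_rpow_of_le_one hμ1
  set D := √(besselJ (ν - 1) 1 ^ 2 + besselJ ν 1 ^ 2)
  refine ⟨C + D, by positivity, fun t ht => ?_⟩
  have hD : 0 ≤ D := Real.sqrt_nonneg _
  have hp : 0 < t ^ μ := by positivity
  have hq : 0 < t ^ ν := by positivity
  rcases le_total t 1 with ht1 | ht1
  · nlinarith [h t ht ht1, mul_nonneg hC hq.le, mul_nonneg hD (add_pos hp hq).le]
  · have hJ : |besselJ μ t| ≤ D * t ^ ν := by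
      refine abs_le_of_sq_le_sq ?_ (by positivity)
      rw [mul_pow, Real.sq_sqrt (by positivity), ← Real.rpow_mul_natCast ht.le, Nat.cast_ofNat, mul_comm ν]
      refine le_trans ?_ (besselJ_sq_add_sq_le hν ht1)
      rcases hμ with rfl | rfl
      · exact le_add_of_nonneg_right (sq_nonneg _)
      · exact le_add_of_nonneg_left (sq_nonneg _)
    nlinarith [mul_nonneg hD hp.le, mul_nonneg hC (add_pos hp hq).le]

lemma integrableOn_rpow_mul_exp_neg_div_rpow {s α r : ℝ} (hs : -1 < s) (hα : 0 < α)
    (hr : 0 < r) :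
    IntegrableOn (fun t : ℝ => t ^ s * Real.exp (-(t / r) ^ α)) (Set.Ioi 0) := by
  refine (integrableOn_rpow_mul_exp_neg_mul_rpow (b := (r ^ α)⁻¹) hs hα (by positivity)).congr_fun
    (fun t ht => ?_) measurableSet_Ioi
  simp only [Real.div_rpow (le_of_lt (Set.mem_Ioi.mp ht)) hr.le]
  ring_nf

lemma integrableOn_rpow_mul_exp_mul_besselJ {ν μ p α r : ℝ} (hν : 0 < ν)
    (hμ : μ = ν - 1 ∨ μ = ν) (hp : -1 < p + μ) (hα : 0 < α) (hr : 0 < r) :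
    IntegrableOn (fun t : ℝ => t ^ p * Real.exp (-(t / r) ^ α) * besselJ μ t) (Set.Ioi 0) := by
  have hμ1 : -1 < μ := by rcases hμ with rfl | rfl <;> linarith
  have hμν : μ ≤ ν := by rcases hμ with rfl | rfl <;> linarith
  obtain ⟨C, hC, h⟩ := exists_abs_besselJ_le hν hμ
  have hI := ((integrableOn_rpow_mul_exp_neg_div_rpow hp hα hr).add
    (integrableOn_rpow_mul_exp_neg_div_rpow (by linarith : -1 < p + ν) hα hr)).const_mul C
  refine Integrable.mono' hI (ContinuousOn.aestronglyMeasurable ?_ measurableSet_Ioi) ?_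
  · refine ContinuousOn.mul (ContinuousOn.mul ?_ ?_) (continuousOn_besselJ hμ1)
    · exact fun t ht => (Real.continuousAt_rpow_const t p (Or.inl (ne_of_gt ht))).continuousWithinAt
    · have : Continuous fun t : ℝ => (t / r) ^ α :=
        (continuous_id.div_const r).rpow_const fun _ => Or.inr hα.le
      exact (Real.continuous_exp.comp this.neg).continuousOn
  · filter_upwards [ae_restrict_mem measurableSet_Ioi] with t ht
    have ht0 : 0 < t := ht
    simp only [Pi.add_apply]
    rw [Real.norm_eq_abs, abs_mul, abs_of_pos (by positivity), Real.rpow_add ht0,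
      Real.rpow_add ht0]
    calc _ ≤ t ^ p * Real.exp (-(t / r) ^ α) * (C * (t ^ μ + t ^ ν)) := by gcongr; exact h t ht0
      _ = _ := by ring

lemma hasDerivAt_rpow_mul_exp_neg_div_rpow (κ α : ℝ) {r t : ℝ} (hr : 0 < r) (ht : 0 < t) :
    HasDerivAt (fun s : ℝ => s ^ κ * Real.exp (-(s / r) ^ α))
      (κ * (t ^ (κ - 1) * Real.exp (-(t / r) ^ α)) -
        α / r ^ α * (t ^ (κ + α - 1) * Real.exp (-(t / r) ^ α))) t := by
  have h1 := (((hasDerivAt_id t).div_const r).rpow_const (p := α)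
    (Or.inl (by simp only [id]; positivity))).neg.exp
  refine (((hasDerivAt_id t).rpow_const (p := κ) (Or.inl ht.ne')).mul h1).congr_deriv ?_
  simp only [id, Pi.neg_apply]
  rw [Real.rpow_sub_one (div_pos ht hr).ne', Real.rpow_sub_one ht.ne', Real.rpow_sub_one ht.ne',
    Real.rpow_add ht, Real.div_rpow ht.le hr.le]
  field_simp
  ring

lemma integral_rpow_mul_exp_mul_besselJ_sub_one {ν κ α r : ℝ} (hν : 0 < ν)
    (hκ : -(2 * ν) < κ) (hα : 0 < α) (hr : 0 < r) :
    ∫ t in Set.Ioi (0 : ℝ), t ^ (ν + κ) * Real.exp (-(t / r) ^ α) * besselJ (ν - 1) t =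
      α / r ^ α * (∫ t in Set.Ioi (0 : ℝ),
        t ^ (ν + κ + α - 1) * Real.exp (-(t / r) ^ α) * besselJ ν t) -
      κ * ∫ t in Set.Ioi (0 : ℝ),
        t ^ (ν + κ - 1) * Real.exp (-(t / r) ^ α) * besselJ ν t := by
  have hA := integrableOn_rpow_mul_exp_mul_besselJ (p := ν + κ) (α := α) (r := r) hν
    (Or.inl rfl) (by linarith) hα hr
  have hB := integrableOn_rpow_mul_exp_mul_besselJ (p := ν + κ + α - 1) (α := α) (r := r) hν
    (Or.inr rfl) (by linarith) hα hr
  have hC := integrableOn_rpow_mul_exp_mul_besselJ (p := ν + κ - 1) (α := α) (r := r) hν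
    (Or.inr rfl) (by linarith) hα hr
  have hD := integrableOn_rpow_mul_exp_mul_besselJ (p := ν + κ) (α := α) (r := r) hν
    (Or.inr rfl) (by linarith) hα hr
  have hderiv : ∀ t ∈ Set.Ioi (0 : ℝ), HasDerivAt
      (fun t => t ^ (ν + κ) * Real.exp (-(t / r) ^ α) * besselJ ν t)
      (t ^ (ν + κ) * Real.exp (-(t / r) ^ α) * besselJ (ν - 1) t -
        (α / r ^ α * (t ^ (ν + κ + α - 1) * Real.exp (-(t / r) ^ α) * besselJ ν t) -
        κ * (t ^ (ν + κ - 1) * Real.exp (-(t / r) ^ α) * besselJ ν t))) t := by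
    intro t ht
    have ht0 : 0 < t := ht
    refine (((hasDerivAt_rpow_mul_besselJ hν ht0).mul
      (hasDerivAt_rpow_mul_exp_neg_div_rpow κ α hr ht0)).congr_of_eventuallyEq ?_).congr_deriv ?_
    · filter_upwards [lt_mem_nhds ht0] with s hs
      simp only [Pi.mul_apply, Real.rpow_add hs]
      ring
    · rw [show ν + κ + α - 1 = ν + (κ + α - 1) by ring, add_sub_assoc ν κ, Real.rpow_add ht0 ν κ,
        Real.rpow_add ht0 ν (κ + α - 1), Real.rpow_add ht0 ν (κ - 1)]
      ring
  have hI := hA.sub ((hB.const_mul (α / r ^ α)).sub (hC.const_mul κ))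
  have h_infty := tendsto_zero_of_hasDerivAt_of_integrableOn_Ioi hderiv hI hD
  have h_zero : Tendsto (fun t => t ^ (ν + κ) * Real.exp (-(t / r) ^ α) * besselJ ν t)
      (nhdsWithin 0 (Set.Ioi 0)) (nhds 0) := by
    obtain ⟨C, hC0, h⟩ := exists_abs_besselJ_le hν (Or.inr rfl : ν = ν - 1 ∨ ν = ν)
    have hpow : Tendsto (fun t : ℝ => 2 * C * t ^ (2 * ν + κ))
        (nhdsWithin 0 (Set.Ioi 0)) (nhds 0) := by
      have := (Real.continuousAt_rpow_const 0 (2 * ν + κ) (Or.inr (by linarith))).tendsto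
      rw [Real.zero_rpow (by linarith)] at this
      simpa using (this.mono_left nhdsWithin_le_nhds).const_mul (2 * C)
    refine squeeze_zero_norm' ?_ hpow
    filter_upwards [self_mem_nhdsWithin] with t ht
    have ht0 : 0 < t := ht
    have hexp : Real.exp (-(t / r) ^ α) ≤ 1 :=
      Real.exp_le_one_iff.mpr (neg_nonpos.mpr (by positivity))
    rw [Real.norm_eq_abs, abs_mul, abs_of_pos (by positivity)]
    calc _ ≤ t ^ (ν + κ) * 1 * (C * (t ^ ν + t ^ ν)) := by gcongr; exact h t ht0
      _ = _ := by
        rw [show 2 * ν + κ = ν + (ν + κ) by ring, Real.rpow_add ht0 ν (ν + κ)]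
        ring
  have key := integral_Ioi_deriv_mul_eq_sub (v := fun _ => 1) (v' := fun _ => 0) (a' := 0) (b' := 0)
    hderiv (fun t _ => hasDerivAt_const t 1) (hI.congr_fun (fun t _ => by simp) measurableSet_Ioi)
    (h_zero.congr fun t => by simp) (h_infty.congr fun t => by simp)
  simp only [mul_one, mul_zero, add_zero, sub_self] at key
  rw [← sub_eq_zero, ← integral_const_mul, ← integral_const_mul,
    ← integral_sub (hB.const_mul _) (hC.const_mul _)]
  exact (integral_sub hA ((hB.const_mul _).sub (hC.const_mul _))).symm.trans key

/-- The recursion `I(d,κ,r) = (α/r^α) I(d+2,κ+α-2,r) - κ I(d+2,κ-2,r)` for `κ > -d`, `r > 0`. -/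
theorem stmt7 (d : ℕ) (hd : 1 ≤ d) (α : ℝ) (hα : α ∈ Set.Ioo (0 : ℝ) 2)
    (κ : ℝ) (hκ : -(d : ℝ) < κ) (r : ℝ) (hr : 0 < r) :
    Ifun d α κ r = α / r ^ α * Ifun (d + 2) α (κ + α - 2) r - κ * Ifun (d + 2) α (κ - 2) r := by
  have hd0 : (0 : ℝ) < d := by exact_mod_cast hd
  have h := integral_rpow_mul_exp_mul_besselJ_sub_one (ν := (d : ℝ) / 2) (κ := κ) (α := α) (r := r)
    (by positivity) (by linarith) hα.1 hr
  simp only [Ifun]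
  push_cast
  rw [show ((d : ℝ) + 2) / 2 + (κ + α - 2) = d / 2 + κ + α - 1 by ring,
    show ((d : ℝ) + 2) / 2 + (κ - 2) = d / 2 + κ - 1 by ring,
    show ((d : ℝ) + 2) / 2 - 1 = d / 2 by ring]
  exact h
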